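/- arXiv:1803.06742 — 3 statements merged into one kernel-verified Lean document; each statement's English description precedes it below -/
import Mathlib

section
/- For every n ≥ 0, every x ∈ X, and every s ∈ ℤ: v^L_n(x) ≤ v'_n(x,s) ≤ v_n(x,s). -/
open Finset

noncomputable section

open scoped Classical

namespace InvCtrl

variable {N M : ℕ} {Z : Type*}

/-- Membership in the belief space `X ⊆ ℝ^N`. -/
def memX (N : ℕ) (x : Fin N → ℝ) : Prop :=
  (∀ i, 0 ≤ x i) ∧ ∑ i, x i = 1

variable [Fintype Z]

/-- `σ(d_k, z, x) = x ⬝ P(d_k, z) ⬝ 𝟙`. -/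
def sigz (P : Fin M → Z → Matrix (Fin N) (Fin N) ℝ) (k : Fin M) (z : Z) (x : Fin N → ℝ) : ℝ :=
  ∑ i, x i * ∑ j, P k z i j

/-- `σ(d_k, x) = ∑_z σ(d_k, z, x)`. -/
def sig (P : Fin M → Z → Matrix (Fin N) (Fin N) ℝ) (k : Fin M) (x : Fin N → ℝ) : ℝ :=
  ∑ z, sigz P k z x

/-- Posterior belief `λ(d_k, z, x) = x P(d_k, z) / σ(d_k, z, x)` (componentwise). -/
def lam (P : Fin M → Z → Matrix (Fin N) (Fin N) ℝ) (k : Fin M) (z : Z) (x : Fin N → ℝ) :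
    Fin N → ℝ :=
  fun j => (∑ i, x i * P k z i j) / sigz P k z x

/-- Single-period cost `c(y, d) = p·(d − y)⁺ + h·(y − d)⁺`. -/
def cst (p hc y dd : ℝ) : ℝ := p * max (dd - y) 0 + hc * max (y - dd) 0

/-- Expected single-period cost `L(x, y) = ∑_k σ(d_k, x) c(y, d_k)`. -/
def Lf (P : Fin M → Z → Matrix (Fin N) (Fin N) ℝ) (d : Fin M → ℤ) (p hc : ℝ)
    (x : Fin N → ℝ) (y : ℝ) : ℝ :=
  ∑ k, sig P k x * cst p hc y (d k : ℝ)

/-- `s*(x)`: the smallest element of `{d_1, …, d_M}` at which `m ↦ L(x, d_m)` is minimized. -/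
def sStar (P : Fin M → Z → Matrix (Fin N) (Fin N) ℝ) (d : Fin M → ℤ) (p hc : ℝ)
    (x : Fin N → ℝ) : ℤ :=
  sInf {t : ℤ | ∃ m : Fin M, t = d m ∧ ∀ k : Fin M, Lf P d p hc x (d m : ℝ) ≤ Lf P d p hc x (d k : ℝ)}

/-- First-order stochastic dominance `x ⪯ x'`. -/
def sdom (x x' : Fin N → ℝ) : Prop :=
  ∀ n : Fin N, ∑ i ∈ univ.filter (fun i => n ≤ i), x i ≤ ∑ i ∈ univ.filter (fun i => n ≤ i), x' i

/-- The `i`-th standard unit vector in `ℝ^N`. -/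
def eV (N : ℕ) (i : Fin N) : Fin N → ℝ := fun j => if j = i then 1 else 0

/-- Assumption A3. -/
def A3 (P : Fin M → Z → Matrix (Fin N) (Fin N) ℝ) : Prop :=
  ∀ i i' : Fin N, i ≤ i' → ∀ m : Fin M,
    ∑ k ∈ univ.filter (fun k : Fin M => m ≤ k), ∑ j, ∑ z, P k z i j ≤
      ∑ k ∈ univ.filter (fun k : Fin M => m ≤ k), ∑ j, ∑ z, P k z i' j

/-- `A_m(x) = h ∑_{k=1}^m σ(d_k,x) − p ∑_{k=m+1}^M σ(d_k,x)` (for `m = 0, …, M`). -/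
def Am (P : Fin M → Z → Matrix (Fin N) (Fin N) ℝ) (p hc : ℝ) (m : ℕ) (x : Fin N → ℝ) : ℝ :=
  hc * ∑ k ∈ univ.filter (fun k : Fin M => (k : ℕ) < m), sig P k x
    - p * ∑ k ∈ univ.filter (fun k : Fin M => m ≤ (k : ℕ)), sig P k x

/-- `B_m(x) = p ∑_{k=m+1}^M d_k σ(d_k,x) − h ∑_{k=1}^m d_k σ(d_k,x)` (for `m = 0, …, M`). -/
def Bm (P : Fin M → Z → Matrix (Fin N) (Fin N) ℝ) (d : Fin M → ℤ) (p hc : ℝ) (m : ℕ)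
    (x : Fin N → ℝ) : ℝ :=
  p * ∑ k ∈ univ.filter (fun k : Fin M => m ≤ (k : ℕ)), (d k : ℝ) * sig P k x
    - hc * ∑ k ∈ univ.filter (fun k : Fin M => (k : ℕ) < m), (d k : ℝ) * sig P k x

/-- Finite-horizon value iteration: `v_0 = 0` and
`v_{n+1}(x,s) = inf_{y ≥ s, y ∈ ℤ} [ L(x,y) + β ∑_{(d_k,z) : σ(d_k,z,x) ≠ 0} σ(d_k,z,x)
v_n(λ(d_k,z,x), f(y,d_k)) ]`, for a general transition `f` of the inventory position. -/
def vIter (P : Fin M → Z → Matrix (Fin N) (Fin N) ℝ) (d : Fin M → ℤ) (p hc β : ℝ)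
    (f : ℤ → ℤ → ℤ) : ℕ → (Fin N → ℝ) → ℤ → ℝ
  | 0, _, _ => 0
  | n + 1, x, s =>
    sInf {r : ℝ | ∃ y : ℤ, s ≤ y ∧
      r = Lf P d p hc x (y : ℝ) + β * ∑ k, ∑ z,
        (if sigz P k z x = 0 then 0
         else sigz P k z x * vIter P d p hc β f n (lam P k z x) (f y (d k)))}

/-- The lower-bound iteration: `v^L_0 = 0` and
`v^L_{n+1}(x) = L(x, s*(x)) + β ∑_{(d_k,z) : σ ≠ 0} σ(d_k,z,x) v^L_n(λ(d_k,z,x))`. -/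
def vLow (P : Fin M → Z → Matrix (Fin N) (Fin N) ℝ) (d : Fin M → ℤ) (p hc β : ℝ) :
    ℕ → (Fin N → ℝ) → ℝ
  | 0, _ => 0
  | n + 1, x =>
    Lf P d p hc x ((sStar P d p hc x : ℤ) : ℝ) + β * ∑ k, ∑ z,
      (if sigz P k z x = 0 then 0
       else sigz P k z x * vLow P d p hc β n (lam P k z x))

/-- The upper-bound iteration (cost of the myopic "order up to `max{s*(x),s}`" policy):
`v^U_0 = 0` and, with `y(x,s) = max{s*(x),s}`,
`v^U_{n+1}(x,s) = L(x,y(x,s)) + β ∑_{(d_k,z) : σ ≠ 0} σ(d_k,z,x)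
v^U_n(λ(d_k,z,x), y(x,s) − d_k)`. -/
def vUp (P : Fin M → Z → Matrix (Fin N) (Fin N) ℝ) (d : Fin M → ℤ) (p hc β : ℝ) :
    ℕ → (Fin N → ℝ) → ℤ → ℝ
  | 0, _, _ => 0
  | n + 1, x, s =>
    Lf P d p hc x ((max (sStar P d p hc x) s : ℤ) : ℝ) + β * ∑ k, ∑ z,
      (if sigz P k z x = 0 then 0
       else sigz P k z x * vUp P d p hc β n (lam P k z x) (max (sStar P d p hc x) s - d k))

theorem sigz_nonneg {P : Fin M → Z → Matrix (Fin N) (Fin N) ℝ} (hP : ∀ k z i j, 0 ≤ P k z i j)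
    {x : Fin N → ℝ} (hx : memX N x) (k : Fin M) (z : Z) : 0 ≤ sigz P k z x :=
  Finset.sum_nonneg fun i _ => mul_nonneg (hx.1 i) (Finset.sum_nonneg fun j _ => hP k z i j)

theorem sig_nonneg {P : Fin M → Z → Matrix (Fin N) (Fin N) ℝ} (hP : ∀ k z i j, 0 ≤ P k z i j)
    {x : Fin N → ℝ} (hx : memX N x) (k : Fin M) : 0 ≤ sig P k x :=
  Finset.sum_nonneg fun z _ => sigz_nonneg hP hx k z

theorem lam_mem {P : Fin M → Z → Matrix (Fin N) (Fin N) ℝ} (hP : ∀ k z i j, 0 ≤ P k z i j)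
    {x : Fin N → ℝ} (hx : memX N x) (k : Fin M) (z : Z) (h : sigz P k z x ≠ 0) :
    memX N (lam P k z x) := by
  refine ⟨fun j => div_nonneg (Finset.sum_nonneg fun i _ => mul_nonneg (hx.1 i) (hP k z i j))
    (sigz_nonneg hP hx k z), ?_⟩
  unfold lam
  rw [← Finset.sum_div, div_eq_one_iff_eq h, Finset.sum_comm]
  simp only [sigz, Finset.mul_sum]

theorem cst_nonneg {p hc : ℝ} (hp : 0 < p) (hh : 0 < hc) (y t : ℝ) : 0 ≤ cst p hc y t := by
  unfold cst; positivity

theorem Lf_nonneg {P : Fin M → Z → Matrix (Fin N) (Fin N) ℝ} (hP : ∀ k z i j, 0 ≤ P k z i j)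
    {x : Fin N → ℝ} (hx : memX N x) (d : Fin M → ℤ) {p hc : ℝ} (hp : 0 < p) (hh : 0 < hc) (y : ℝ) :
    0 ≤ Lf P d p hc x y :=
  Finset.sum_nonneg fun k _ => mul_nonneg (sig_nonneg hP hx k) (cst_nonneg hp hh _ _)

theorem cont_mono {P : Fin M → Z → Matrix (Fin N) (Fin N) ℝ} (hP : ∀ k z i j, 0 ≤ P k z i j)
    {x : Fin N → ℝ} (hx : memX N x) {β : ℝ} (hβ : 0 ≤ β) (F G : Fin M → Z → ℝ)
    (h : ∀ k z, sigz P k z x ≠ 0 → F k z ≤ G k z) :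
    β * ∑ k, ∑ z, (if sigz P k z x = 0 then 0 else sigz P k z x * F k z) ≤
    β * ∑ k, ∑ z, (if sigz P k z x = 0 then 0 else sigz P k z x * G k z) := by
  refine mul_le_mul_of_nonneg_left (Finset.sum_le_sum fun k _ => Finset.sum_le_sum fun z _ => ?_) hβ
  split_ifs with h0
  · exact le_rfl
  · exact mul_le_mul_of_nonneg_left (h k z h0) (sigz_nonneg hP hx k z)

theorem cont_nonneg {P : Fin M → Z → Matrix (Fin N) (Fin N) ℝ} (hP : ∀ k z i j, 0 ≤ P k z i j)
    {x : Fin N → ℝ} (hx : memX N x) {β : ℝ} (hβ : 0 ≤ β) (G : Fin M → Z → ℝ)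
    (h : ∀ k z, sigz P k z x ≠ 0 → 0 ≤ G k z) :
    0 ≤ β * ∑ k, ∑ z, (if sigz P k z x = 0 then 0 else sigz P k z x * G k z) := by
  simpa using cont_mono hP hx hβ (fun _ _ => 0) G h

theorem vIter_nonneg {P : Fin M → Z → Matrix (Fin N) (Fin N) ℝ} (hP : ∀ k z i j, 0 ≤ P k z i j)
    (d : Fin M → ℤ) {p hc β : ℝ} (hp : 0 < p) (hh : 0 < hc) (hβ : 0 ≤ β) (f : ℤ → ℤ → ℤ) (n : ℕ) :
    ∀ (x : Fin N → ℝ) (s : ℤ), memX N x → 0 ≤ vIter P d p hc β f n x s := by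
  induction n with
  | zero => intro x s _; simp [vIter]
  | succ n ih =>
    intro x s hx
    rw [vIter]
    apply Real.sInf_nonneg
    rintro r ⟨y, _, rfl⟩
    exact add_nonneg (Lf_nonneg hP hx d hp hh _)
      (cont_nonneg hP hx hβ _ fun k z h0 => ih _ _ (lam_mem hP hx k z h0))

theorem cst_interp {p hc a b w t : ℝ} (haw : a ≤ w) (hwb : w ≤ b) (ht : t ≤ a ∨ b ≤ t) :
    (b - a) * cst p hc w t = (b - w) * cst p hc a t + (w - a) * cst p hc b t := by
  unfold cst
  rcases ht with ht | ht
  · rw [max_eq_right (by linarith : t - w ≤ 0), max_eq_right (by linarith : t - a ≤ 0),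
      max_eq_right (by linarith : t - b ≤ 0), max_eq_left (by linarith : 0 ≤ w - t),
      max_eq_left (by linarith : 0 ≤ a - t), max_eq_left (by linarith : 0 ≤ b - t)]
    ring
  · rw [max_eq_left (by linarith : 0 ≤ t - w), max_eq_left (by linarith : 0 ≤ t - a),
      max_eq_left (by linarith : 0 ≤ t - b), max_eq_right (by linarith : w - t ≤ 0),
      max_eq_right (by linarith : a - t ≤ 0), max_eq_right (by linarith : b - t ≤ 0)]
    ring

theorem exists_break {P : Fin M → Z → Matrix (Fin N) (Fin N) ℝ} (hM : 1 ≤ M)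
    (hP : ∀ k z i j, 0 ≤ P k z i j)
    {x : Fin N → ℝ} (hx : memX N x) (d : Fin M → ℤ) {p hc : ℝ} (hp : 0 < p) (hh : 0 < hc) (w : ℤ) :
    ∃ m, Lf P d p hc x (d m : ℝ) ≤ Lf P d p hc x (w : ℝ) := by
  have : Nonempty (Fin M) := ⟨⟨0, hM⟩⟩
  by_cases h1 : ∀ k, w ≤ d k
  · obtain ⟨m, _, hm⟩ := Finset.exists_min_image univ d univ_nonempty
    refine ⟨m, Finset.sum_le_sum fun k _ => mul_le_mul_of_nonneg_left ?_ (sig_nonneg hP hx k)⟩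
    have e1 : (w : ℝ) ≤ d m := by exact_mod_cast h1 m
    have e2 : (d m : ℝ) ≤ d k := by exact_mod_cast hm k (mem_univ k)
    unfold cst
    rw [max_eq_right (by linarith : (d m : ℝ) - d k ≤ 0),
      max_eq_right (by linarith : (w : ℝ) - d k ≤ 0),
      max_eq_left (by linarith : (0 : ℝ) ≤ d k - d m),
      max_eq_left (by linarith : (0 : ℝ) ≤ d k - w)]
    nlinarith
  by_cases h2 : ∀ k, d k ≤ w
  · obtain ⟨m, _, hm⟩ := Finset.exists_max_image univ d univ_nonempty
    refine ⟨m, Finset.sum_le_sum fun k _ => mul_le_mul_of_nonneg_left ?_ (sig_nonneg hP hx k)⟩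
    have e1 : (d m : ℝ) ≤ w := by exact_mod_cast h2 m
    have e2 : (d k : ℝ) ≤ d m := by exact_mod_cast hm k (mem_univ k)
    unfold cst
    rw [max_eq_left (by linarith : (0 : ℝ) ≤ (d m : ℝ) - d k),
      max_eq_left (by linarith : (0 : ℝ) ≤ (w : ℝ) - d k),
      max_eq_right (by linarith : (d k : ℝ) - d m ≤ 0),
      max_eq_right (by linarith : (d k : ℝ) - w ≤ 0)]
    nlinarith
  push Not at h1 h2
  obtain ⟨k1, hk1⟩ := h1
  obtain ⟨k2, hk2⟩ := h2
  obtain ⟨a, ha, ha'⟩ := Finset.exists_max_image (univ.filter fun k => d k ≤ w) d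
    ⟨k1, by simp [hk1.le]⟩
  obtain ⟨b, hb, hb'⟩ := Finset.exists_min_image (univ.filter fun k => w < d k) d
    ⟨k2, by simp [hk2]⟩
  simp only [mem_filter, mem_univ, true_and] at ha ha' hb hb'
  have ea : (d a : ℝ) ≤ w := by exact_mod_cast ha
  have eb : (w : ℝ) < d b := by exact_mod_cast hb
  have key : ((d b : ℝ) - d a) * Lf P d p hc x w =
      (d b - w) * Lf P d p hc x (d a) + (w - d a) * Lf P d p hc x (d b) := by
    unfold Lf
    rw [Finset.mul_sum, Finset.mul_sum, Finset.mul_sum, ← Finset.sum_add_distrib]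
    refine Finset.sum_congr rfl fun k _ => ?_
    have := cst_interp (p := p) (hc := hc) (t := d k) ea eb.le (by
      rcases le_or_gt (d k) w with h | h
      · left; exact_mod_cast ha' k h
      · right; exact_mod_cast hb' k h)
    linear_combination sig P k x * this
  by_contra! hcon
  have ca := hcon a
  have cb := hcon b
  nlinarith [mul_nonneg (sub_nonneg.2 ea) (sub_nonneg.2 cb.le), mul_pos (sub_pos.2 eb) (sub_pos.2 ca)]

theorem Lf_sStar_le {P : Fin M → Z → Matrix (Fin N) (Fin N) ℝ} (hM : 1 ≤ M)
    (hP : ∀ k z i j, 0 ≤ P k z i j)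
    {x : Fin N → ℝ} (hx : memX N x) (d : Fin M → ℤ) {p hc : ℝ} (hp : 0 < p) (hh : 0 < hc) (w : ℤ) :
    Lf P d p hc x ((sStar P d p hc x : ℤ) : ℝ) ≤ Lf P d p hc x (w : ℝ) := by
  have : Nonempty (Fin M) := ⟨⟨0, hM⟩⟩
  have hmem : sStar P d p hc x ∈ {t : ℤ | ∃ m : Fin M, t = d m ∧
      ∀ k : Fin M, Lf P d p hc x (d m : ℝ) ≤ Lf P d p hc x (d k : ℝ)} := by
    apply Int.csInf_mem
    · obtain ⟨m, _, hm⟩ := Finset.exists_min_image univ (fun m => Lf P d p hc x (d m : ℝ))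
        univ_nonempty
      exact ⟨d m, m, rfl, fun k => hm k (mem_univ k)⟩
    · apply Set.Finite.bddBelow
      apply (Set.finite_range d).subset
      rintro t ⟨m, rfl, _⟩
      exact ⟨m, rfl⟩
  obtain ⟨m, hm, hmin⟩ := hmem
  obtain ⟨k, hk⟩ := exists_break hM hP hx d hp hh w
  rw [hm]
  exact (hmin k).trans hk

theorem Lf_shift (P : Fin M → Z → Matrix (Fin N) (Fin N) ℝ) (d : Fin M → ℤ) (p hc : ℝ)
    (x : Fin N → ℝ) (δ y : ℤ) :
    Lf P (fun k => d k + δ) p hc x (y : ℝ) = Lf P d p hc x ((y - δ : ℤ) : ℝ) := by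
  unfold Lf cst
  refine Finset.sum_congr rfl fun k _ => ?_
  push_cast
  congr 4 <;> ring

/-- Proposition 5: the value iteration `v'` of the `δ`-shifted problem
(`L'(x,y) = ∑_k σ(d_k,x) c(y, d_k + δ)`, next inventory `y − d_k − δ`) is squeezed between
the lower bound `v^L` and the optimal cost `v`:
`v^L_n(x) ≤ v'_n(x,s) ≤ v_n(x,s)`.  Note that `v'` is exactly `vIter` run on the shifted
demand vector `fun k => d k + δ`. -/
theorem stmt15 {N M : ℕ} {Z : Type*} [Fintype Z] [Nonempty Z]
    (hN : 1 ≤ N) (hM : 1 ≤ M)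
    (d : Fin M → ℤ) (hd : StrictMono d)
    (P : Fin M → Z → Matrix (Fin N) (Fin N) ℝ)
    (hPnn : ∀ k z i j, 0 ≤ P k z i j)
    (hPst : ∀ i : Fin N, ∑ k : Fin M, ∑ z : Z, ∑ j : Fin N, P k z i j = 1)
    (p hc : ℝ) (hp : 0 < p) (hhc : 0 < hc)
    (β : ℝ) (hβ0 : 0 ≤ β) (hβ1 : β < 1)
    (δ : ℤ) (hδ : 0 ≤ δ) :
    ∀ (n : ℕ) (x : Fin N → ℝ) (s : ℤ), memX N x →
      vLow P d p hc β n x ≤ vIter P (fun k => d k + δ) p hc β (fun y dd => y - dd) n x s ∧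
      vIter P (fun k => d k + δ) p hc β (fun y dd => y - dd) n x s ≤
        vIter P d p hc β (fun y dd => y - dd) n x s := by
  intro n
  induction n with
  | zero => intro x s _; simp [vIter, vLow]
  | succ n ih =>
    intro x s hx
    constructor
    · rw [vIter, vLow]
      apply le_csInf
      · exact ⟨_, s, le_rfl, rfl⟩
      rintro r ⟨y, _, rfl⟩
      rw [Lf_shift]
      exact add_le_add (Lf_sStar_le hM hPnn hx d hp hhc _)
        (cont_mono hPnn hx hβ0 _ _ fun k z h0 => (ih _ _ (lam_mem hPnn hx k z h0)).1)
    · rw [vIter, vIter]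
      apply le_csInf
      · exact ⟨_, s, le_rfl, rfl⟩
      rintro r ⟨y, hy, rfl⟩
      refine le_trans (csInf_le ?_ ⟨y + δ, by omega, rfl⟩) ?_
      · refine ⟨0, ?_⟩
        rintro r ⟨y, _, rfl⟩
        exact add_nonneg (Lf_nonneg hPnn hx _ hp hhc _)
          (cont_nonneg hPnn hx hβ0 _ fun k z h0 =>
            vIter_nonneg hPnn _ hp hhc hβ0 _ n _ _ (lam_mem hPnn hx k z h0))
      · rw [Lf_shift, add_sub_cancel_right]
        refine add_le_add le_rfl (cont_mono hPnn hx hβ0 _ _ fun k z h0 => ?_)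
        have e : y + δ - (d k + δ) = y - d k := by ring
        rw [e]
        exact (ih _ _ (lam_mem hPnn hx k z h0)).2

end InvCtrl
end
end

section
/- Let K ≥ 0 and β ∈ [0,1), and let v : X × ℝ → ℝ be such that for every x ∈ X the map v(x,·) is K-convex, continuous, and bounded below. Then for every x ∈ X: (1) Gv(x,·) is K-convex, continuous, and Gv(x,y) → ∞ as |y| → ∞; and (2) for every s ∈ ℝ the infimum defining H^Kv(x,s) is attained, and the map s ↦ H^Kv(x,s) is K-convex. -/
open Finset

noncomputable section

open scoped Classical

namespace InvCtrl

variable {N M : ℕ} {Z : Type*}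

variable [Fintype Z]

/-- `g` is `K`-convex: `g(λ s + (1−λ) s') ≤ λ g(s) + (1−λ)(g(s') + K)` for `s ≤ s'`,
`λ ∈ [0,1]`. -/
def KConvexFn (K : ℝ) (g : ℝ → ℝ) : Prop :=
  ∀ a b : ℝ, a ≤ b → ∀ t : ℝ, 0 ≤ t → t ≤ 1 →
    g (t * a + (1 - t) * b) ≤ t * g a + (1 - t) * (g b + K)

/-- The operator `G`: `Gv(x,y) = L(x,y) + β ∑_{(d_k,z) : σ ≠ 0} σ(d_k,z,x)
v(λ(d_k,z,x), y − d_k)`. -/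
def Gop (P : Fin M → Z → Matrix (Fin N) (Fin N) ℝ) (d : Fin M → ℤ) (p hc β : ℝ)
    (v : (Fin N → ℝ) → ℝ → ℝ) (x : Fin N → ℝ) (y : ℝ) : ℝ :=
  Lf P d p hc x y + β * ∑ k, ∑ z,
    (if sigz P k z x = 0 then 0 else sigz P k z x * v (lam P k z x) (y - (d k : ℝ)))

/-- The operator `H^K`: `H^Kv(x,s) = inf_{y ≥ s} [ K ξ(y−s) + Gv(x,y) ]` with `ξ(0) = 0`
and `ξ(t) = 1` otherwise. -/
def HKop (P : Fin M → Z → Matrix (Fin N) (Fin N) ℝ) (d : Fin M → ℤ) (p hc β K : ℝ)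
    (v : (Fin N → ℝ) → ℝ → ℝ) (x : Fin N → ℝ) (s : ℝ) : ℝ :=
  sInf {r : ℝ | ∃ y : ℝ, s ≤ y ∧
    r = K * (if y = s then 0 else 1) + Gop P d p hc β v x y}

/-- Attainment of the infimum in the definition of `H`. -/
lemma attain_aux (K : ℝ) (hK : 0 ≤ K) (g : ℝ → ℝ) (hg : Continuous g)
    (hco : Filter.Tendsto g (Filter.cocompact ℝ) Filter.atTop) (s : ℝ) :
    ∃ y : ℝ, s ≤ y ∧ ∀ y', s ≤ y' →
      K * (if y = s then 0 else 1) + g y ≤ K * (if y' = s then 0 else 1) + g y' := by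
  obtain ⟨y0, hy0, hmin⟩ := hg.continuousOn.exists_isMinOn' (s := Set.Ici s) isClosed_Ici
    (x₀ := s) (Set.mem_Ici.2 le_rfl)
    (Filter.Eventually.filter_mono inf_le_left (hco.eventually_ge_atTop (g s)))
  have hmin' : ∀ y, s ≤ y → g y0 ≤ g y := fun y hy => hmin (Set.mem_Ici.2 hy)
  by_cases h : g s ≤ K + g y0
  · refine ⟨s, le_rfl, fun y' hy' => ?_⟩
    have := hmin' y' hy'
    by_cases e : y' = s
    · simp [e]
    · simp [e]; linarith
  · refine ⟨y0, hy0, fun y' hy' => ?_⟩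
    have h1 := hmin' y' hy'
    by_cases e : y' = s
    · subst e
      by_cases e' : y0 = y'
      · simp [e']
      · simp [e']; linarith
    · by_cases e' : y0 = s
      · simp [e, e'] ; rw [e'] at h1; linarith
      · simp [e, e']; linarith

/-- `K`-convexity of the optimal value function. -/
lemma kconv_aux (K : ℝ) (hK : 0 ≤ K) (g H : ℝ → ℝ) (hg : KConvexFn K g)
    (h1 : ∀ s y, s ≤ y → H s ≤ K * (if y = s then 0 else 1) + g y)
    (h2 : ∀ s, ∃ y, s ≤ y ∧ K * (if y = s then 0 else 1) + g y = H s) :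
    KConvexFn K H := by
  have hs : ∀ s, H s ≤ g s := fun s => by simpa using h1 s s le_rfl
  have hy : ∀ s y, s ≤ y → H s ≤ K + g y := fun s y h => by
    have := h1 s y h
    split_ifs at this <;> linarith
  intro a b hab t ht0 ht1
  obtain ⟨ya, hya, ea⟩ := h2 a
  obtain ⟨yb, hyb, eb⟩ := h2 b
  have hgb : g yb ≤ H b := by split_ifs at eb <;> linarith
  have hga : g ya ≤ H a := by split_ifs at ea <;> linarith
  have hac : a ≤ t * a + (1 - t) * b := by nlinarith
  have hcb : t * a + (1 - t) * b ≤ b := by nlinarith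
  generalize hc : t * a + (1 - t) * b = c at *
  by_cases h : c ≤ ya
  · have k1 : H c ≤ H a := by
      by_cases e : ya = a
      · have : c = a := by linarith
        rw [this]
      · have := hy c ya h
        simp [e] at ea
        linarith
    have k2 : H c ≤ H b + K := by
      have := hy c yb (by linarith)
      linarith
    nlinarith
  · push Not at h
    have hpos : 0 < yb - ya := by linarith
    have k := hg ya yb (by linarith) ((yb - c) / (yb - ya))
      (div_nonneg (by linarith) hpos.le) ((div_le_one hpos).2 (by linarith))
    have hr : t ≤ (yb - c) / (yb - ya) := by
      rw [le_div_iff₀ hpos]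
      nlinarith [mul_nonneg (sub_nonneg.2 ht1) (sub_nonneg.2 hyb),
        mul_nonneg ht0 (sub_nonneg.2 hya)]
    have hce : (yb - c) / (yb - ya) * ya + (1 - (yb - c) / (yb - ya)) * yb = c := by
      field_simp
      ring
    rw [hce] at k
    generalize (yb - c) / (yb - ya) = r at *
    have k3 := hy a yb (by linarith)
    have k4 := hs c
    have k5 : g ya ≤ K + g yb := by linarith
    nlinarith [mul_nonneg (sub_nonneg.2 hr) (sub_nonneg.2 k5),
      mul_nonneg ht0 (sub_nonneg.2 hga), mul_nonneg (sub_nonneg.2 ht1) (sub_nonneg.2 hgb)]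

lemma max_conv_aux (u w t : ℝ) (ht0 : 0 ≤ t) (ht1 : t ≤ 1) :
    max (t * u + (1 - t) * w) 0 ≤ t * max u 0 + (1 - t) * max w 0 := by
  have h1 := mul_le_mul_of_nonneg_left (le_max_left u 0) ht0
  have h2 := mul_le_mul_of_nonneg_left (le_max_left w 0) (sub_nonneg.2 ht1)
  have h3 := mul_nonneg ht0 (le_max_right u 0)
  have h4 := mul_nonneg (sub_nonneg.2 ht1) (le_max_right w 0)
  exact max_le (by linarith) (by linarith)

lemma cst_conv_aux (p hc : ℝ) (hp : 0 < p) (hhc : 0 < hc) (a b t e : ℝ) (ht0 : 0 ≤ t)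
    (ht1 : t ≤ 1) :
    cst p hc (t * a + (1 - t) * b) e ≤ t * cst p hc a e + (1 - t) * cst p hc b e := by
  unfold cst
  have h1 := mul_le_mul_of_nonneg_left (max_conv_aux (e - a) (e - b) t ht0 ht1) hp.le
  have h2 := mul_le_mul_of_nonneg_left (max_conv_aux (a - e) (b - e) t ht0 ht1) hhc.le
  rw [show t * (e - a) + (1 - t) * (e - b) = e - (t * a + (1 - t) * b) by ring] at h1
  rw [show t * (a - e) + (1 - t) * (b - e) = (t * a + (1 - t) * b) - e by ring] at h2
  linarith

lemma cst_lower_aux (p hc : ℝ) (hp : 0 < p) (hhc : 0 < hc) (y e : ℝ) :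
    min p hc * (|y| - |e|) ≤ cst p hc y e := by
  have hm : 0 < min p hc := lt_min hp hhc
  have h1 : |y| - |e| ≤ max (e - y) 0 + max (y - e) 0 := by
    have := abs_sub_abs_le_abs_sub y e
    rcases le_total y e with h | h
    · rw [abs_of_nonpos (sub_nonpos.2 h)] at this
      have := le_max_left (e - y) 0
      have := le_max_right (y - e) 0
      linarith
    · rw [abs_of_nonneg (sub_nonneg.2 h)] at this
      have := le_max_right (e - y) 0
      have := le_max_left (y - e) 0
      linarith
  have h2 := mul_le_mul_of_nonneg_left h1 hm.le
  have h3 := mul_le_mul_of_nonneg_right (min_le_left p hc) (le_max_right (e - y) 0)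
  have h4 := mul_le_mul_of_nonneg_right (min_le_right p hc) (le_max_right (y - e) 0)
  unfold cst
  linarith

/-- Proposition 6, parts 1–2: if `v(x,·)` is `K`-convex, continuous and
bounded below for each `x ∈ X`, then `Gv(x,·)` is `K`-convex, continuous and coercive, the
infimum defining `H^Kv(x,s)` is attained, and `H^Kv(x,·)` is `K`-convex. -/
theorem stmt16 {N M : ℕ} {Z : Type*} [Fintype Z] [Nonempty Z]
    (hN : 1 ≤ N) (hM : 1 ≤ M)
    (d : Fin M → ℤ) (hd : StrictMono d)
    (P : Fin M → Z → Matrix (Fin N) (Fin N) ℝ)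
    (hPnn : ∀ k z i j, 0 ≤ P k z i j)
    (hPst : ∀ i : Fin N, ∑ k : Fin M, ∑ z : Z, ∑ j : Fin N, P k z i j = 1)
    (p hc : ℝ) (hp : 0 < p) (hhc : 0 < hc)
    (K : ℝ) (hK : 0 ≤ K) (β : ℝ) (hβ0 : 0 ≤ β) (hβ1 : β < 1)
    (v : (Fin N → ℝ) → ℝ → ℝ)
    (hv : ∀ x : Fin N → ℝ, memX N x →
      KConvexFn K (v x) ∧ Continuous (v x) ∧ BddBelow (Set.range (v x))) :
    ∀ x : Fin N → ℝ, memX N x →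
      -- (1)
      (KConvexFn K (fun y => Gop P d p hc β v x y) ∧
        Continuous (fun y => Gop P d p hc β v x y) ∧
        Filter.Tendsto (fun y => Gop P d p hc β v x y) (Filter.cocompact ℝ) Filter.atTop) ∧
      -- (2)
      (∀ s : ℝ, ∃ y : ℝ, s ≤ y ∧
        K * (if y = s then 0 else 1) + Gop P d p hc β v x y = HKop P d p hc β K v x s) ∧
      KConvexFn K (fun s => HKop P d p hc β K v x s) := by
  intro x hx
  have hs0 : ∀ k z, 0 ≤ sigz P k z x := fun k z =>
    Finset.sum_nonneg fun i _ => mul_nonneg (hx.1 i) (Finset.sum_nonneg fun j _ => hPnn k z i j)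
  have hsum : ∑ k, ∑ z, sigz P k z x = 1 := by
    unfold sigz
    calc ∑ k, ∑ z, ∑ i, x i * ∑ j, P k z i j
        = ∑ k, ∑ i, ∑ z, x i * ∑ j, P k z i j :=
          Finset.sum_congr rfl fun k _ => Finset.sum_comm
      _ = ∑ i, ∑ k, ∑ z, x i * ∑ j, P k z i j := Finset.sum_comm
      _ = ∑ i, x i * ∑ k, ∑ z, ∑ j, P k z i j := by simp only [Finset.mul_sum]
      _ = 1 := by simp only [hPst, mul_one]; exact hx.2
  have hsig0 : ∀ k, 0 ≤ sig P k x := fun k => Finset.sum_nonneg fun z _ => hs0 k z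
  have hsigsum : ∑ k, sig P k x = 1 := hsum
  have hlam : ∀ k z, sigz P k z x ≠ 0 → memX N (lam P k z x) := by
    intro k z hne
    refine ⟨fun j => div_nonneg (Finset.sum_nonneg fun i _ =>
      mul_nonneg (hx.1 i) (hPnn k z i j)) (hs0 k z), ?_⟩
    unfold lam
    rw [← Finset.sum_div, Finset.sum_comm]
    simp only [← Finset.mul_sum]
    exact div_self hne
  have hKc : KConvexFn K (fun y => Gop P d p hc β v x y) := by
    intro a b hab t ht0 ht1
    have hL : Lf P d p hc x (t * a + (1 - t) * b)
        ≤ t * Lf P d p hc x a + (1 - t) * Lf P d p hc x b := by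
      unfold Lf
      rw [Finset.mul_sum, Finset.mul_sum, ← Finset.sum_add_distrib]
      refine Finset.sum_le_sum fun k _ => ?_
      have := mul_le_mul_of_nonneg_left
        (cst_conv_aux p hc hp hhc a b t (d k) ht0 ht1) (hsig0 k)
      linarith
    have hT : ∑ k, ∑ z, (if sigz P k z x = 0 then 0 else
          sigz P k z x * v (lam P k z x) (t * a + (1 - t) * b - (d k : ℝ)))
        ≤ t * (∑ k, ∑ z, (if sigz P k z x = 0 then 0 else
          sigz P k z x * v (lam P k z x) (a - (d k : ℝ))))
        + (1 - t) * (∑ k, ∑ z, (if sigz P k z x = 0 then 0 else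
          sigz P k z x * v (lam P k z x) (b - (d k : ℝ))))
        + (1 - t) * K * ∑ k, ∑ z, sigz P k z x := by
      simp only [Finset.mul_sum]
      simp only [← Finset.sum_add_distrib]
      refine Finset.sum_le_sum fun k _ => Finset.sum_le_sum fun z _ => ?_
      by_cases e : sigz P k z x = 0
      · simp [e]
      · simp only [e, if_false]
        have h := (hv _ (hlam k z e)).1 (a - d k) (b - d k) (by linarith) t ht0 ht1
        rw [show t * (a - (d k : ℝ)) + (1 - t) * (b - d k) = t * a + (1 - t) * b - d k by ring]
          at h
        have := mul_le_mul_of_nonneg_left h (hs0 k z)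
        linarith
    rw [hsum, mul_one] at hT
    have h3 := mul_le_mul_of_nonneg_left hT hβ0
    have h4 := mul_nonneg (mul_nonneg (sub_nonneg.2 ht1) hK) (sub_nonneg.2 hβ1.le)
    simp only [Gop]
    linarith
  have hcont : Continuous (fun y => Gop P d p hc β v x y) := by
    unfold Gop Lf cst
    refine Continuous.add (by fun_prop) (continuous_const.mul ?_)
    refine continuous_finset_sum _ fun k _ => continuous_finset_sum _ fun z _ => ?_
    by_cases e : sigz P k z x = 0
    · simp only [e, if_true]; exact continuous_const
    · simp only [e, if_false]
      exact continuous_const.mul ((hv _ (hlam k z e)).2.1.comp (by fun_prop))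
  have hco : Filter.Tendsto (fun y => Gop P d p hc β v x y) (Filter.cocompact ℝ)
      Filter.atTop := by
    have hw : ∀ k z, ∃ w : ℝ, ∀ y, w ≤ (if sigz P k z x = 0 then 0 else
          sigz P k z x * v (lam P k z x) (y - (d k : ℝ))) := by
      intro k z
      by_cases e : sigz P k z x = 0
      · exact ⟨0, fun y => by simp [e]⟩
      · obtain ⟨w, hw⟩ := (hv _ (hlam k z e)).2.2
        refine ⟨sigz P k z x * w, fun y => ?_⟩
        simp only [e, if_false]
        exact mul_le_mul_of_nonneg_left (hw ⟨_, rfl⟩) (hs0 k z)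
    choose w hw using hw
    have hm : 0 < min p hc := lt_min hp hhc
    have hlow : ∀ y, min p hc * ‖y‖ + (β * (∑ k, ∑ z, w k z)
        - ∑ k, sig P k x * (min p hc * |(d k : ℝ)|)) ≤ Gop P d p hc β v x y := by
      intro y
      have h1 := mul_le_mul_of_nonneg_left
        (Finset.sum_le_sum fun k (_ : k ∈ univ) =>
          Finset.sum_le_sum fun z (_ : z ∈ univ) => hw k z y) hβ0
      have h2 : min p hc * ‖y‖ - ∑ k, sig P k x * (min p hc * |(d k : ℝ)|)
          ≤ Lf P d p hc x y := by
        have : min p hc * ‖y‖ = ∑ k, sig P k x * (min p hc * ‖y‖) := by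
          rw [← Finset.sum_mul, hsigsum, one_mul]
        rw [this, ← Finset.sum_sub_distrib]
        unfold Lf
        refine Finset.sum_le_sum fun k _ => ?_
        have := mul_le_mul_of_nonneg_left (cst_lower_aux p hc hp hhc y (d k)) (hsig0 k)
        rw [Real.norm_eq_abs]
        linarith
      unfold Gop
      linarith
    refine Filter.tendsto_atTop_mono hlow ?_
    exact Filter.tendsto_atTop_add_const_right _ _
      ((tendsto_norm_cocompact_atTop (E := ℝ)).const_mul_atTop hm)
  have hatt := attain_aux K hK _ hcont hco
  have hH : ∀ s : ℝ, ∃ y : ℝ, s ≤ y ∧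
        K * (if y = s then 0 else 1) + Gop P d p hc β v x y = HKop P d p hc β K v x s := by
    intro s
    obtain ⟨y, hy, hmin⟩ := hatt s
    refine ⟨y, hy, ?_⟩
    have : IsLeast {r : ℝ | ∃ y : ℝ, s ≤ y ∧
        r = K * (if y = s then 0 else 1) + Gop P d p hc β v x y}
        (K * (if y = s then 0 else 1) + Gop P d p hc β v x y) := by
      refine ⟨⟨y, hy, rfl⟩, ?_⟩
      rintro r ⟨y', hy', rfl⟩
      exact hmin y' hy'
    exact this.csInf_eq.symm
  refine ⟨⟨hKc, hcont, hco⟩, hH, ?_⟩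
  refine kconv_aux K hK _ _ hKc ?_ hH
  intro s y hy
  obtain ⟨y0, hy0, hmin⟩ := hatt s
  refine csInf_le ⟨K * (if y0 = s then 0 else 1) + Gop P d p hc β v x y0, ?_⟩ ⟨y, hy, rfl⟩
  rintro r ⟨y', hy', rfl⟩
  exact hmin y' hy'

end InvCtrl
end
end

section
/- Let K ≥ 0 and let g : ℝ → ℝ be K-convex, continuous, and satisfy g(y) → ∞ as |y| → ∞. Then g attains its minimum; let S be a minimizer of g and set s = inf{t ≤ S : g(t) ≤ K + g(S)}, which is attained (g(s) ≤ K + g(S)). Then: (i) g(t) > K + g(S) for every t < s; (ii) g(t) ≤ K + g(y) whenever s ≤ t ≤ y; and consequently (iii) for every t ∈ ℝ, inf_{y ≥ t} [ K·ξ(y−t) + g(y) ] equals K + g(S) if t < s, and equals g(t) if t ≥ s, where ξ(0) = 0 and ξ(u) = 1 for u ≠ 0. -/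
open Finset

noncomputable section

open scoped Classical

namespace InvCtrl

variable {N M : ℕ} {Z : Type*}

variable [Fintype Z]

/-- the structural result behind `(s,S)`-policies.  A `K`-convex,
continuous and coercive `g : ℝ → ℝ` attains its minimum; if `S` is a minimizer and
`s = inf { t ≤ S : g(t) ≤ K + g(S) }`, then the infimum is attained, `g > K + g(S)`
strictly to the left of `s`, `g(t) ≤ K + g(y)` for `s ≤ t ≤ y`, and
`inf_{y ≥ t}[K ξ(y−t) + g(y)]` equals `K + g(S)` for `t < s` and `g(t)` for `t ≥ s`. -/
theorem stmt17 (K : ℝ) (hK : 0 ≤ K) (g : ℝ → ℝ)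
    (hKc : KConvexFn K g) (hcont : Continuous g)
    (hcoer : Filter.Tendsto g (Filter.cocompact ℝ) Filter.atTop) :
    (∃ S : ℝ, ∀ y : ℝ, g S ≤ g y) ∧
    ∀ S : ℝ, (∀ y : ℝ, g S ≤ g y) →
      ∀ s : ℝ, s = sInf {t : ℝ | t ≤ S ∧ g t ≤ K + g S} →
        -- `s` is attained
        (g s ≤ K + g S ∧ s ≤ S) ∧
        -- (i)
        (∀ t : ℝ, t < s → K + g S < g t) ∧
        -- (ii)
        (∀ t y : ℝ, s ≤ t → t ≤ y → g t ≤ K + g y) ∧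
        -- (iii)
        (∀ t : ℝ,
          sInf {r : ℝ | ∃ y : ℝ, t ≤ y ∧ r = K * (if y = t then 0 else 1) + g y} =
            if t < s then K + g S else g t) := by
  have key : ∀ a b t C : ℝ, a ≤ t → t ≤ b → g a ≤ C → g b + K ≤ C → g t ≤ C := by
    intro a b t C hat htb ha hb
    rcases eq_or_lt_of_le (hat.trans htb) with hab | hab
    · have : t = a := le_antisymm (hab ▸ htb) hat
      rw [this]; exact ha
    · have hpos : 0 < b - a := sub_pos.2 hab
      have h0 : 0 ≤ (b - t) / (b - a) := div_nonneg (by linarith) hpos.le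
      have h1 : (b - t) / (b - a) ≤ 1 := by
        rw [div_le_one hpos]; linarith
      have h := hKc a b hab.le _ h0 h1
      have e : (b - t) / (b - a) * a + (1 - (b - t) / (b - a)) * b = t := by
        field_simp
        ring
      rw [e] at h
      nlinarith [mul_le_mul_of_nonneg_left ha h0,
        mul_le_mul_of_nonneg_left hb (sub_nonneg.2 h1)]
  refine ⟨hcont.exists_forall_le hcoer, ?_⟩
  intro S hS s hs
  have hne : {t : ℝ | t ≤ S ∧ g t ≤ K + g S}.Nonempty := ⟨S, le_refl S, by linarith⟩
  have hbdd : BddBelow {t : ℝ | t ≤ S ∧ g t ≤ K + g S} := by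
    obtain ⟨b, hb⟩ := Filter.eventually_atBot.1
      ((hcoer.mono_left atBot_le_cocompact).eventually (Filter.eventually_gt_atTop (K + g S)))
    refine ⟨b, fun t ht => ?_⟩
    by_contra hlt
    have := hb t (not_le.1 hlt).le
    exact absurd ht.2 (not_le.2 this)
  have hcl : IsClosed {t : ℝ | t ≤ S ∧ g t ≤ K + g S} :=
    (isClosed_le continuous_id continuous_const).inter (isClosed_le hcont continuous_const)
  have hmem : s ≤ S ∧ g s ≤ K + g S := by
    rw [hs]
    exact hcl.csInf_mem hne hbdd
  have hi : ∀ t : ℝ, t < s → K + g S < g t := by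
    intro t ht
    by_contra hcon
    have : s ≤ t := by
      rw [hs]
      exact csInf_le hbdd ⟨ht.le.trans hmem.1, not_lt.1 hcon⟩
    linarith
  have hii : ∀ t y : ℝ, s ≤ t → t ≤ y → g t ≤ K + g y := by
    intro t y hst hty
    have hy := hS y
    rcases le_total t S with htS | htS
    · have := key s S t (K + g S) hst htS hmem.2 (by linarith)
      linarith
    · exact key S y t (K + g y) htS hty (by linarith) (by linarith)
  refine ⟨⟨hmem.2, hmem.1⟩, hi, hii, ?_⟩
  intro t
  apply IsLeast.csInf_eq
  by_cases hts : t < s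
  · rw [if_pos hts]
    refine ⟨⟨S, by linarith [hmem.1], ?_⟩, ?_⟩
    · rw [if_neg (by linarith [hmem.1] : t < S).ne', mul_one]
    · rintro r ⟨y, hy, rfl⟩
      split_ifs with h
      · rw [h]; linarith [hi t hts]
      · linarith [hS y]
  · rw [if_neg hts]
    refine ⟨⟨t, le_refl t, by simp⟩, ?_⟩
    rintro r ⟨y, hy, rfl⟩
    split_ifs with h
    · rw [h]; linarith
    · linarith [hii t y (not_lt.1 hts) hy]

end InvCtrl
end
end
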